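/- arXiv:2105.09695 — 4 statements merged into one kernel-verified Lean document; each statement's English description precedes it below -/
import Mathlib

section
/- Let n ≥ 1 and let A : ℝ → Matrix (Fin n) (Fin n) ℝ be continuous on the interval [t₀, ∞). Define the iterated integrals of the Peano–Baker series by P₀(t) = I (the identity matrix) and P_{k+1}(t) = ∫_{t₀}^{t} A(s) * P_k(s) ds for t ≥ t₀. Then for every fixed t ≥ t₀ the family (P_k(t))_{k ∈ ℕ} is summable in the normed space of n×n real matrices; in particular, if ‖A(s)‖ ≤ M for all s ∈ [t₀, t], then ‖P_k(t)‖ ≤ (M (t − t₀))^k / k! for every k. -/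
open Matrix MeasureTheory

attribute [local instance]
  Matrix.linftyOpNormedAddCommGroup Matrix.linftyOpNormedRing
  Matrix.linftyOpNormedSpace Matrix.linftyOpNormedAlgebra

/-- Iterated integrals `P (k + 1) u = ∫ s in t₀..u, A s * P k s` in a normed algebra, with
`‖P 0‖ ≤ 1` and `‖A‖ ≤ M` on `[t₀, t]`, satisfy `‖P k u‖ ≤ (M * (u - t₀)) ^ k / k!`. -/
theorem norm_iterated_integral_le {R : Type*} [NormedRing R] [NormedAlgebra ℝ R]
    {t₀ t M : ℝ} {A : ℝ → R} {P : ℕ → ℝ → R}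
    (hP0 : ∀ u ∈ Set.Icc t₀ t, ‖P 0 u‖ ≤ 1)
    (hPsucc : ∀ k : ℕ, ∀ u ∈ Set.Icc t₀ t, P (k + 1) u = ∫ s in t₀..u, A s * P k s)
    (hM : ∀ s ∈ Set.Icc t₀ t, ‖A s‖ ≤ M) (k : ℕ) :
    ∀ u ∈ Set.Icc t₀ t, ‖P k u‖ ≤ (M * (u - t₀)) ^ k / (Nat.factorial k : ℝ) := by
  induction k with
  | zero => simpa using hP0
  | succ k ih =>
    intro u hu
    have hbound : ‖∫ s in t₀..u, A s * P k s‖ ≤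
        ∫ s in t₀..u, M * ((M * (s - t₀)) ^ k / (Nat.factorial k : ℝ)) := by
      refine intervalIntegral.norm_integral_le_of_norm_le hu.1
        (Filter.Eventually.of_forall fun s hs => ?_)
        (Continuous.intervalIntegrable (by fun_prop) _ _)
      have hs' : s ∈ Set.Icc t₀ t := ⟨hs.1.le, hs.2.trans hu.2⟩
      exact (norm_mul_le _ _).trans (mul_le_mul (hM s hs') (ih s hs') (norm_nonneg _)
        ((norm_nonneg _).trans (hM s hs')))
    have hint : ∫ s in t₀..u, M * ((M * (s - t₀)) ^ k / (Nat.factorial k : ℝ)) =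
        (M * (u - t₀)) ^ (k + 1) / (Nat.factorial (k + 1) : ℝ) := by
      have hpow : ∫ s in t₀..u, (s - t₀) ^ k = (u - t₀) ^ (k + 1) / (k + 1) := by
        rw [intervalIntegral.integral_comp_sub_right (fun x : ℝ => x ^ k), integral_pow]
        simp
      simp only [mul_pow, intervalIntegral.integral_const_mul, intervalIntegral.integral_div,
        hpow, Nat.factorial_succ, Nat.cast_mul, Nat.cast_add, Nat.cast_one]
      field_simp
      ring
    rw [hPsucc k u hu]
    exact hbound.trans hint.le

/-- Let `n ≥ 1` and `A : ℝ → Matrix (Fin n) (Fin n) ℝ` be continuous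
on `[t₀, ∞)`. Define the iterated integrals of the Peano–Baker series by `P 0 t = 1`
and `P (k+1) t = ∫ s in t₀..t, A s * P k s` for `t ≥ t₀`. Then for every `t ≥ t₀`
the family `(P k t)ₖ` is summable in the (submultiplicative) matrix normed space;
in particular, if `‖A s‖ ≤ M` on `[t₀, t]`, then `‖P k t‖ ≤ (M (t − t₀))^k / k!`. -/
theorem peano_baker_series_summable
    (n : ℕ) (hn : 1 ≤ n) (t₀ : ℝ)
    (A : ℝ → Matrix (Fin n) (Fin n) ℝ)
    (hA : ContinuousOn A (Set.Ici t₀))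
    (P : ℕ → ℝ → Matrix (Fin n) (Fin n) ℝ)
    (hP0 : ∀ t, P 0 t = 1)
    (hPsucc : ∀ k : ℕ, ∀ t ≥ t₀, P (k + 1) t = ∫ s in t₀..t, A s * P k s)
    (t : ℝ) (ht : t₀ ≤ t) :
    Summable (fun k : ℕ => P k t) ∧
      ∀ M : ℝ, (∀ s ∈ Set.Icc t₀ t, ‖A s‖ ≤ M) →
        ∀ k : ℕ, ‖P k t‖ ≤ (M * (t - t₀)) ^ k / (Nat.factorial k : ℝ) := by
  have hbound (M : ℝ) (hM : ∀ s ∈ Set.Icc t₀ t, ‖A s‖ ≤ M) (k : ℕ) :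
      ‖P k t‖ ≤ (M * (t - t₀)) ^ k / (Nat.factorial k : ℝ) := by
    have : Nonempty (Fin n) := ⟨⟨0, hn⟩⟩
    have : NormOneClass (Matrix (Fin n) (Fin n) ℝ) := Matrix.linfty_opNormOneClass
    exact norm_iterated_integral_le (fun u _ => by rw [hP0, norm_one])
      (fun k u hu => hPsucc k u hu.1) hM k t ⟨ht, le_rfl⟩
  obtain ⟨M, hM⟩ := isCompact_Icc.exists_bound_of_continuousOn
    (hA.mono (Set.Icc_subset_Ici_self : Set.Icc t₀ t ⊆ Set.Ici t₀))
  have : CompleteSpace (Matrix (Fin n) (Fin n) ℝ) := FiniteDimensional.complete ℝ _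
  exact ⟨Summable.of_norm_bounded (Real.summable_pow_div_factorial _) (hbound M hM), hbound⟩
end

section
/- Let n ≥ 1 and let A : ℝ → Matrix (Fin n) (Fin n) ℝ be continuous on [t₀, ∞). Define P₀(t) = I and P_{k+1}(t) = ∫_{t₀}^{t} A(s) * P_k(s) ds for t ≥ t₀, and let Λ(t) = ∑'_{k ∈ ℕ} P_k(t) (the sum of the Peano–Baker series, which is summable). Then Λ(t₀) = I and for every t ≥ t₀ the function Λ is differentiable at t with derivative Λ'(t) = A(t) * Λ(t); that is, the Peano–Baker series is a fundamental solution of the linear time-varying ordinary differential equation dx/dt = A(t) x. -/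
open Matrix MeasureTheory

attribute [local instance]
  Matrix.linftyOpNormedAddCommGroup Matrix.linftyOpNormedRing
  Matrix.linftyOpNormedSpace Matrix.linftyOpNormedAlgebra

section PeanoBaker

variable {R : Type*} [NormedRing R] [NormedAlgebra ℝ R]
  {t₀ : ℝ} {B : ℝ → R} {Q : ℕ → ℝ → R}

/-- The iterated integrals of a continuous function are continuous. -/
theorem continuous_iterated_integral (hB : Continuous B) (hQ0 : ∀ t, Q 0 t = 1)
    (hQ : ∀ k t, Q (k + 1) t = ∫ s in t₀..max t t₀, B s * Q k s) (k : ℕ) :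
    Continuous (Q k) := by
  induction k with
  | zero => exact (continuous_const (y := (1 : R))).congr fun t => (hQ0 t).symm
  | succ k ih =>
    have h : Continuous fun t => ∫ s in t₀..t, B s * Q k s :=
      intervalIntegral.continuous_primitive
        (fun a b => (hB.mul ih).intervalIntegrable a b) t₀
    exact (h.comp (continuous_id.max continuous_const)).congr fun t => (hQ k t).symm

/-- The factorial bound on the iterated integrals over a bounded interval. -/
theorem norm_iterated_integral_le_s1 {M T : ℝ}
    (hM : ∀ s ∈ Set.Icc t₀ T, ‖B s‖ ≤ M) (hQ0 : ∀ t, Q 0 t = 1)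
    (hQ : ∀ k t, Q (k + 1) t = ∫ s in t₀..max t t₀, B s * Q k s) (k : ℕ)
    {t : ℝ} (ht : t ∈ Set.Icc t₀ T) :
    ‖Q k t‖ ≤ ‖(1 : R)‖ * ((M * (t - t₀)) ^ k / k.factorial) := by
  have hM0 : 0 ≤ M := (norm_nonneg _).trans (hM t ht)
  induction k generalizing t with
  | zero => simp [hQ0]
  | succ k ih =>
    rw [hQ, max_eq_left ht.1]
    have hbound : ∀ s ∈ Set.Ioc t₀ t, ‖B s * Q k s‖ ≤
        M * (‖(1 : R)‖ * ((M * (s - t₀)) ^ k / k.factorial)) := fun s hs =>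
      (norm_mul_le _ _).trans <|
        mul_le_mul (hM s ⟨hs.1.le, hs.2.trans ht.2⟩) (ih ⟨hs.1.le, hs.2.trans ht.2⟩)
          (norm_nonneg _) hM0
    refine (intervalIntegral.norm_integral_le_of_norm_le ht.1
      (Filter.Eventually.of_forall hbound)
      (Continuous.intervalIntegrable (by fun_prop) _ _)).trans_eq ?_
    have hpow : ∫ s in t₀..t, (s - t₀) ^ k = (t - t₀) ^ (k + 1) / (k + 1) := by
      rw [intervalIntegral.integral_comp_sub_right (fun s => s ^ k) t₀]
      simp
    have hrw : ∀ s : ℝ, M * (‖(1 : R)‖ * ((M * (s - t₀)) ^ k / k.factorial)) =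
        M ^ (k + 1) * ‖(1 : R)‖ / k.factorial * (s - t₀) ^ k := fun s => by
      rw [mul_pow]; ring
    simp_rw [hrw]
    rw [intervalIntegral.integral_const_mul, hpow, Nat.factorial_succ]
    push_cast
    rw [mul_pow]
    field_simp

/-- On a half-line bounded above, the iterated integrals are dominated by a summable sequence. -/
theorem exists_summable_bound_iterated_integral (hB : Continuous B) (hQ0 : ∀ t, Q 0 t = 1)
    (hQ : ∀ k t, Q (k + 1) t = ∫ s in t₀..max t t₀, B s * Q k s) (T : ℝ) :
    ∃ u : ℕ → ℝ, Summable u ∧ ∀ k, ∀ t ≤ T, ‖Q k t‖ ≤ u k := by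
  obtain ⟨M, hM⟩ := (isCompact_Icc (a := t₀) (b := max T t₀)).exists_bound_of_continuousOn
    hB.continuousOn
  have hM0 : 0 ≤ M := (norm_nonneg _).trans (hM t₀ ⟨le_rfl, le_max_right _ _⟩)
  have hmax : ∀ k t, Q k t = Q k (max t t₀) := fun k t => by
    cases k with
    | zero => rw [hQ0, hQ0]
    | succ k => rw [hQ, hQ, max_eq_left (le_max_right t t₀)]
  refine ⟨fun k => ‖(1 : R)‖ * ((M * (max T t₀ - t₀)) ^ k / k.factorial),
    (Real.summable_pow_div_factorial _).mul_left _, fun k t ht => ?_⟩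
  rw [hmax]
  have hle : max t t₀ ≤ max T t₀ := max_le_max_right _ ht
  have h0 : 0 ≤ max t t₀ - t₀ := sub_nonneg.2 (le_max_right _ _)
  refine (norm_iterated_integral_le_s1 hM hQ0 hQ k ⟨le_max_right _ _, hle⟩).trans ?_
  have hpow := pow_le_pow_left₀ (mul_nonneg hM0 h0)
    (mul_le_mul_of_nonneg_left (sub_le_sub_right hle t₀) hM0) k
  exact mul_le_mul_of_nonneg_left (div_le_div_of_nonneg_right hpow (Nat.cast_nonneg _))
    (norm_nonneg _)

/-- The Peano–Baker series of a continuous function solves the linear equation. -/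
theorem hasDerivWithinAt_tsum_iterated_integral [CompleteSpace R] (hB : Continuous B)
    (hQ0 : ∀ t, Q 0 t = 1)
    (hQ : ∀ k t, Q (k + 1) t = ∫ s in t₀..max t t₀, B s * Q k s) :
    ∑' k, Q k t₀ = 1 ∧ ∀ t ≥ t₀,
      HasDerivWithinAt (fun t => ∑' k, Q k t) (B t * ∑' k, Q k t) (Set.Ici t₀) t := by
  have hcont := continuous_iterated_integral hB hQ0 hQ
  have hdom := exists_summable_bound_iterated_integral hB hQ0 hQ
  have hsum : ∀ t, Summable fun k => Q k t := fun t => by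
    obtain ⟨u, hu, hle⟩ := hdom t
    exact Summable.of_norm_bounded hu fun k => hle k t le_rfl
  have hsumcont : Continuous fun t => ∑' k, Q k t := by
    refine continuous_iff_continuousAt.2 fun t => ?_
    obtain ⟨u, hu, hle⟩ := hdom (t + 1)
    exact (continuousOn_tsum (s := Set.Iic (t + 1)) (fun k => (hcont k).continuousOn) hu
      fun k s hs => hle k s hs).continuousAt (Iic_mem_nhds (lt_add_one t))
  have hint : ∀ t ≥ t₀, ∑' k, Q k t = 1 + ∫ s in t₀..t, B s * ∑' k, Q k s := by
    intro t ht
    obtain ⟨u, hu, hle⟩ := hdom t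
    have h : HasSum (fun k => ∫ s in t₀..t, B s * Q k s)
        (∫ s in t₀..t, B s * ∑' k, Q k s) := by
      refine intervalIntegral.hasSum_integral_of_dominated_convergence
        (fun k s => ‖B s‖ * u k)
        (fun k => (hB.mul (hcont k)).aestronglyMeasurable)
        (fun k => Filter.Eventually.of_forall fun s hs => ?_)
        (Filter.Eventually.of_forall fun s _ => hu.mul_left _) ?_
        (Filter.Eventually.of_forall fun s _ => (hsum s).hasSum.mul_left _)
      · rw [Set.uIoc_of_le ht] at hs
        exact (norm_mul_le _ _).trans (by gcongr; exact hle k s hs.2)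
      · simp_rw [tsum_mul_left]
        exact (hB.norm.mul continuous_const).intervalIntegrable _ _
    rw [(hsum t).tsum_eq_zero_add, hQ0]
    simp_rw [hQ, max_eq_left ht]
    rw [h.tsum_eq]
  refine ⟨by simpa using hint t₀ le_rfl, fun t ht => ?_⟩
  have hd : HasDerivAt (fun t => 1 + ∫ s in t₀..t, B s * ∑' k, Q k s)
      (B t * ∑' k, Q k t) t :=
    ((hB.mul hsumcont).integral_hasStrictDerivAt t₀ t).hasDerivAt.const_add 1
  exact hd.hasDerivWithinAt.congr (fun s hs => hint s hs) (hint t ht)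

end PeanoBaker

/-- Let `n ≥ 1` and `A : ℝ → Matrix (Fin n) (Fin n) ℝ` be continuous
on `[t₀, ∞)`. With `P 0 t = 1`, `P (k+1) t = ∫ s in t₀..t, A s * P k s` for `t ≥ t₀`,
let `Λ t = ∑' k, P k t` be the sum of the Peano–Baker series. Then `Λ t₀ = 1` and for
every `t ≥ t₀` the function `Λ` is differentiable (within `[t₀, ∞)`) at `t` with
derivative `A t * Λ t`; i.e. the Peano–Baker series is a fundamental solution of
`dx/dt = A(t) x`. -/
theorem peano_baker_series_fundamental_solution
    (n : ℕ) (hn : 1 ≤ n) (t₀ : ℝ)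
    (A : ℝ → Matrix (Fin n) (Fin n) ℝ)
    (hA : ContinuousOn A (Set.Ici t₀))
    (P : ℕ → ℝ → Matrix (Fin n) (Fin n) ℝ)
    (hP0 : ∀ t, P 0 t = 1)
    (hPsucc : ∀ k : ℕ, ∀ t ≥ t₀, P (k + 1) t = ∫ s in t₀..t, A s * P k s)
    (Λ : ℝ → Matrix (Fin n) (Fin n) ℝ)
    (hΛ : ∀ t, Λ t = ∑' k : ℕ, P k t) :
    Λ t₀ = 1 ∧ ∀ t ≥ t₀, HasDerivWithinAt Λ (A t * Λ t) (Set.Ici t₀) t := by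
  have hB : Continuous fun t => A (max t t₀) :=
    hA.comp_continuous (continuous_id.max continuous_const) fun t => le_max_right t t₀
  obtain ⟨h0, hd⟩ := hasDerivWithinAt_tsum_iterated_integral (t₀ := t₀)
    (Q := fun k t => P k (max t t₀)) hB (fun t => hP0 _) fun k t => by
      rw [hPsucc k _ (le_max_right t t₀)]
      refine intervalIntegral.integral_congr fun s hs => ?_
      rw [Set.uIcc_of_le (le_max_right t t₀)] at hs
      simp only [max_eq_left hs.1]
  have hΛ' : ∀ t ≥ t₀, Λ t = ∑' k, P k (max t t₀) := fun t ht => by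
    rw [hΛ, max_eq_left ht]
  refine ⟨(hΛ' t₀ le_rfl).trans h0, fun t ht => ?_⟩
  have h := (hd t ht).congr (fun s hs => hΛ' s hs) (hΛ' t ht)
  rw [max_eq_left ht] at h
  exact h.congr_deriv (congrArg (A t * ·) (hΛ t).symm)
end

section
/- (ADMM primal-step descent inequality.) Let g : ℝⁿ → ℝ be differentiable and satisfy the quadratic bound |g(x) − g(y) − ⟨∇g(y), x − y⟩| ≤ (L/2) ‖x − y‖² for all x, y ∈ ℝⁿ and some L ≥ 0. Let Φ be an n×n real matrix, let λ_min denote the smallest eigenvalue of Φᵀ Φ, let v, η ∈ ℝⁿ, and let ρ > 0 satisfy (ρ/2) λ_min − L/2 ≥ 0. Define the augmented Lagrangian ℒ(z) = g(z) + ⟨η, Φ z − v⟩ + (ρ/2) ‖Φ z − v‖². Suppose z' ∈ ℝⁿ is a stationary point of ℒ, i.e., ∇g(z') + Φᵀ η + ρ Φᵀ (Φ z' − v) = 0. Then for every z ∈ ℝⁿ, ℒ(z) − ℒ(z') ≥ ((ρ/2) λ_min − L/2) ‖z − z'‖² ≥ 0. -/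
open Matrix RealInnerProductSpace

/-- The Rayleigh quotient of a real Hermitian matrix is bounded below by any lower bound of its
eigenvalues. -/
lemma Matrix.IsHermitian.mul_norm_sq_le_inner_toEuclideanLin {ι : Type*} [Fintype ι]
    [DecidableEq ι] {A : Matrix ι ι ℝ} (hA : A.IsHermitian) {c : ℝ}
    (hc : ∀ i, c ≤ hA.eigenvalues i) (x : EuclideanSpace ℝ ι) :
    c * ‖x‖ ^ 2 ≤ ⟪x, Matrix.toEuclideanLin A x⟫ := by
  have hb (i : ι) : ⟪hA.eigenvectorBasis i, Matrix.toEuclideanLin A x⟫ =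
      hA.eigenvalues i * ⟪hA.eigenvectorBasis i, x⟫ := by
    have h : Matrix.toEuclideanLin A (hA.eigenvectorBasis i) =
        hA.eigenvalues i • hA.eigenvectorBasis i := by
      ext j
      simpa using congrFun (hA.mulVec_eigenvectorBasis i) j
    rw [← Matrix.isSymmetric_toEuclideanLin_iff.2 hA, h, real_inner_smul_left]
  rw [← real_inner_self_eq_norm_sq, ← hA.eigenvectorBasis.sum_inner_mul_inner x x,
    ← hA.eigenvectorBasis.sum_inner_mul_inner x, Finset.mul_sum]
  refine Finset.sum_le_sum fun i _ => ?_
  rw [hb, real_inner_comm x]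
  nlinarith [mul_le_mul_of_nonneg_right (hc i) (mul_self_nonneg ⟪x, hA.eigenvectorBasis i⟫),
    real_inner_comm x (hA.eigenvectorBasis i)]

/-- The transpose of a real matrix is its adjoint for the Euclidean inner product. -/
lemma Matrix.inner_toEuclideanLin_transpose {m ι : Type*} [Fintype m] [DecidableEq m] [Fintype ι]
    [DecidableEq ι] (A : Matrix m ι ℝ) (y : EuclideanSpace ℝ m) (x : EuclideanSpace ℝ ι) :
    ⟪Matrix.toEuclideanLin Aᵀ y, x⟫ = ⟪y, Matrix.toEuclideanLin A x⟫ := by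
  rw [← Matrix.conjTranspose_eq_transpose_of_trivial,
    Matrix.toEuclideanLin_conjTranspose_eq_adjoint, LinearMap.adjoint_inner_left]

/-- **ADMM primal-step descent inequality.** Let `g : ℝⁿ → ℝ` be
differentiable with `|g(x) − g(y) − ⟨∇g(y), x − y⟩| ≤ (L/2)‖x − y‖²`, let `Φ` be an
`n×n` real matrix with `λ_min` the smallest eigenvalue of `Φᵀ Φ`, let `v, η ∈ ℝⁿ`, and
let `ρ > 0` satisfy `(ρ/2) λ_min − L/2 ≥ 0`.  If `z'` is a stationary point of the
augmented Lagrangian `ℒ(z) = g(z) + ⟨η, Φz − v⟩ + (ρ/2)‖Φz − v‖²`, i.e.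
`∇g(z') + Φᵀ η + ρ Φᵀ(Φ z' − v) = 0`, then for every `z`,
`ℒ(z) − ℒ(z') ≥ ((ρ/2) λ_min − L/2) ‖z − z'‖² ≥ 0`. -/
theorem admm_primal_step_descent
    (n : ℕ) (g : EuclideanSpace ℝ (Fin n) → ℝ)
    (gradg : EuclideanSpace ℝ (Fin n) → EuclideanSpace ℝ (Fin n))
    (hg : ∀ z, HasGradientAt g (gradg z) z)
    (L : ℝ) (hL : 0 ≤ L)
    (hquad : ∀ x y, |g x - g y - ⟪gradg y, x - y⟫| ≤ L / 2 * ‖x - y‖ ^ 2)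
    (Φ : Matrix (Fin n) (Fin n) ℝ) (hH : (Φᵀ * Φ).IsHermitian)
    (lammin : ℝ) (hle : ∀ i, lammin ≤ hH.eigenvalues i)
    (hmem : ∃ i, hH.eigenvalues i = lammin)
    (v η : EuclideanSpace ℝ (Fin n)) (ρ : ℝ) (hρ : 0 < ρ)
    (hcond : 0 ≤ ρ / 2 * lammin - L / 2)
    (ℒ : EuclideanSpace ℝ (Fin n) → ℝ)
    (hℒ : ∀ z, ℒ z = g z + ⟪η, Matrix.toEuclideanLin Φ z - v⟫
        + ρ / 2 * ‖Matrix.toEuclideanLin Φ z - v‖ ^ 2)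
    (z' : EuclideanSpace ℝ (Fin n))
    (hstat : gradg z' + Matrix.toEuclideanLin Φᵀ η
        + ρ • Matrix.toEuclideanLin Φᵀ (Matrix.toEuclideanLin Φ z' - v) = 0) :
    ∀ z, ℒ z - ℒ z' ≥ (ρ / 2 * lammin - L / 2) * ‖z - z'‖ ^ 2 ∧
      (ρ / 2 * lammin - L / 2) * ‖z - z'‖ ^ 2 ≥ 0 := by
  intro z
  refine ⟨?_, mul_nonneg hcond (sq_nonneg _)⟩
  set d := z - z' with hd
  set w := Matrix.toEuclideanLin Φ z' - v with hw
  have hz : Matrix.toEuclideanLin Φ z - v = w + Matrix.toEuclideanLin Φ d := by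
    rw [hd, hw, map_sub]
    abel
  have hray : lammin * ‖d‖ ^ 2 ≤ ‖Matrix.toEuclideanLin Φ d‖ ^ 2 := by
    have hmul : Matrix.toEuclideanLin (Φᵀ * Φ) d =
        Matrix.toEuclideanLin Φᵀ (Matrix.toEuclideanLin Φ d) := by
      ext j
      simp [Matrix.mulVec_mulVec]
    have h := hH.mul_norm_sq_le_inner_toEuclideanLin hle d
    rwa [hmul, real_inner_comm, Matrix.inner_toEuclideanLin_transpose,
      real_inner_self_eq_norm_sq] at h
  have hst := congrArg (fun u => ⟪u, d⟫) hstat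
  simp only [inner_add_left, real_inner_smul_left, Matrix.inner_toEuclideanLin_transpose,
    inner_zero_left] at hst
  have hlow := (abs_le.1 (hquad z z')).1
  rw [hℒ, hℒ, hz, inner_add_right, norm_add_sq_real]
  nlinarith [mul_le_mul_of_nonneg_left hray hρ.le]
end

section
/- Let C : ℝ → Matrix (Fin T) (Fin T) ℝ be differentiable at u with derivative C'(u), and suppose C(u) is symmetric and positive definite (in particular invertible with positive determinant). Fix x ∈ ℝ^T. Then the function u ↦ log det C(u) + xᵀ C(u)⁻¹ x is differentiable at u with derivative tr[ (C(u)⁻¹ − C(u)⁻¹ x xᵀ C(u)⁻¹) C'(u) ], where tr denotes the matrix trace and x xᵀ is the outer product. -/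
open Matrix

section

attribute [local instance] Matrix.linftyOpNormedRing Matrix.linftyOpNormedAlgebra

/-- The entrywise derivative of the inverse along a curve of matrices. -/
theorem Matrix.hasDerivAt_inv_apply {n : Type*} [Fintype n] [DecidableEq n]
    {C : ℝ → Matrix n n ℝ} {C' : Matrix n n ℝ} {u : ℝ}
    (hC : ∀ i j, HasDerivAt (fun t => C t i j) (C' i j) u) (hu : IsUnit (C u)) (i j : n) :
    HasDerivAt (fun t => (C t)⁻¹ i j) ((-((C u)⁻¹ * C' * (C u)⁻¹)) i j) u := by
  have hC₁ : HasDerivAt C C' u := hasDerivAt_pi.2 fun i => hasDerivAt_pi.2 fun j => hC i j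
  obtain ⟨U, hU⟩ := hu
  have h := hasFDerivAt_ringInverse (𝕜 := ℝ) U
  rw [hU] at h
  have h₂ := h.comp_hasDerivAt u hC₁
  have h₃ : HasDerivAt (fun t => (C t)⁻¹) (-((C u)⁻¹ * C' * (C u)⁻¹)) u := by
    have e₁ : (fun t => (C t)⁻¹) = Ring.inverse ∘ C :=
      funext fun t => Matrix.nonsing_inv_eq_ringInverse _
    have e₂ : -((C u)⁻¹ * C' * (C u)⁻¹) =
        (-ContinuousLinearMap.mulLeftRight ℝ (Matrix n n ℝ) ↑U⁻¹ ↑U⁻¹) C' := by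
      rw [← hU, ← Matrix.coe_units_inv]
      rfl
    rw [e₁, e₂]
    exact h₂
  exact hasDerivAt_pi.1 (hasDerivAt_pi.1 h₃ i) j

end

attribute [local instance] Matrix.normedAddCommGroup Matrix.normedSpace

/-- **Jacobi's formula** for the derivative of a determinant along a curve of matrices. -/
theorem HasDerivAt.matrix_det {n : Type*} [Fintype n] [DecidableEq n] {C : ℝ → Matrix n n ℝ}
    {C' : Matrix n n ℝ} {u : ℝ} (hC : HasDerivAt C C' u) :
    HasDerivAt (fun t => (C t).det) (((C u).adjugate * C').trace) u := by
  let f : ContinuousMultilinearMap ℝ (fun _ : n => n → ℝ) ℝ :=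
    { toMultilinearMap := (Matrix.detRowAlternating (n := n) (R := ℝ)).toMultilinearMap
      cont := Continuous.matrix_det continuous_id }
  have h := (f.hasFDerivAt (C u)).comp_hasDerivAt u hC
  have e : f.linearDeriv (C u) C' = ((C u).adjugate * C').trace := by
    rw [Matrix.trace_mul_comm]
    refine (ContinuousMultilinearMap.linearDeriv_apply f (C u) C').trans ?_
    refine Finset.sum_congr rfl fun i _ => ?_
    change ((C u).updateRow i (C' i)).det = _
    rw [← Matrix.cramer_transpose_apply, Matrix.cramer_eq_adjugate_mulVec,
      ← Matrix.adjugate_transpose, Matrix.mulVec_transpose]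
    rfl
  rw [← e]
  exact h

/-- Let `C : ℝ → Matrix (Fin T) (Fin T) ℝ` be differentiable at `u`
with derivative `C'`, with `C u` symmetric positive definite, and fix `x ∈ ℝ^T`. Then
`u ↦ log det C(u) + xᵀ C(u)⁻¹ x` is differentiable at `u` with derivative
`tr[(C(u)⁻¹ − C(u)⁻¹ x xᵀ C(u)⁻¹) C']`. -/
theorem hasDerivAt_logdet_add_quadratic_inv
    (T : ℕ) (C : ℝ → Matrix (Fin T) (Fin T) ℝ) (u : ℝ)
    (C' : Matrix (Fin T) (Fin T) ℝ) (hC : HasDerivAt C C' u)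
    (hpd : (C u).PosDef) (x : Fin T → ℝ) :
    HasDerivAt (fun u => Real.log (C u).det + x ⬝ᵥ (C u)⁻¹ *ᵥ x)
      (Matrix.trace (((C u)⁻¹ - (C u)⁻¹ * Matrix.vecMulVec x x * (C u)⁻¹) * C')) u := by
  have hlog := hC.matrix_det.log hpd.det_pos.ne'
  have hinv := Matrix.hasDerivAt_inv_apply
    (fun i j => hasDerivAt_pi.1 (hasDerivAt_pi.1 hC i) j) hpd.isUnit
  have hquad : HasDerivAt (fun t => x ⬝ᵥ (C t)⁻¹ *ᵥ x)
      (x ⬝ᵥ (-((C u)⁻¹ * C' * (C u)⁻¹)) *ᵥ x) u := by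
    simp only [dotProduct, Matrix.mulVec]
    exact HasDerivAt.fun_sum fun i _ => (HasDerivAt.fun_sum fun j _ =>
      (hinv i j).mul_const (x j)).const_mul (x i)
  have hdet : ((C u).adjugate * C').trace / (C u).det = ((C u)⁻¹ * C').trace := by
    rw [Matrix.inv_def, Matrix.smul_mul, Matrix.trace_smul, Ring.inverse_eq_inv', smul_eq_mul,
      div_eq_inv_mul]
  have htr : ((C u)⁻¹ * Matrix.vecMulVec x x * (C u)⁻¹ * C').trace =
      x ⬝ᵥ ((C u)⁻¹ * C' * (C u)⁻¹) *ᵥ x := by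
    rw [Matrix.mul_assoc, Matrix.trace_mul_comm, ← Matrix.mul_assoc, Matrix.mul_vecMulVec,
      Matrix.trace_vecMulVec, dotProduct_comm]
  rw [Matrix.sub_mul, Matrix.trace_sub, htr, sub_eq_add_neg, ← dotProduct_neg,
    ← Matrix.neg_mulVec, ← hdet]
  exact hlog.add hquad
end
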